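/- Let V > 0, κ > 0, 0 < r_s < r_a < r_d with r_d < r_s + r_a and r_a² > r_d·r_s, k = 1/√(r_d² − r_a²), β = √(r_d² − r_a²)/r_a, and 0 < δ ≤ arctan(β)/β + ln(r_d/r_a) − r_s/r_a. Let r, θ : [0,∞) → ℝ be differentiable functions satisfying the hybrid closed-loop equations r'(t) = −V·cos θ(t) and θ'(t) = Ω(r(t), θ(t)) + V·sin θ(t)/r(t), where Ω(r,θ) = f(r,θ) if r ≥ r_a and Ω(r,θ) = 0 if r < r_a. If r(0) ≥ r_a, θ(0) ∈ (0, π), and η(r(0), θ(0)) < δ, then r(t) → r_d and θ(t) → π/2 as t → ∞, and r(t) ≥ r_s for all t ≥ 0. -/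

import Mathlib

open MeasureTheory intervalIntegral Real Filter

noncomputable def phi (r_a r_d k r : ℝ) : ℝ :=
  ∫ σ in r_d..r, (k * Real.sqrt (σ ^ 2 - r_a ^ 2) / σ - 1 / σ)

noncomputable def eta (r_a r_d k r θ : ℝ) : ℝ := 1 - Real.sin θ + phi r_a r_d k r

/-- The proposed turn-rate control law outside the auxiliary circle. -/
noncomputable def ctrl (V κ δ r_a r_d k r θ : ℝ) : ℝ :=
  (V / r) * (1 - Real.sin θ) - k * V * Real.sqrt (r ^ 2 - r_a ^ 2) / r
    + κ * Real.cos θ / (δ ^ 2 - (eta r_a r_d k r θ) ^ 2)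

/-- The hybrid control law: `ctrl` outside the auxiliary circle, `0` inside. -/
noncomputable def Omega (V κ δ r_a r_d k r θ : ℝ) : ℝ :=
  if r_a ≤ r then ctrl V κ δ r_a r_d k r θ else 0

open Set Topology

theorem arctan_lt_self_of_pos {x : ℝ} (hx : 0 < x) : Real.arctan x < x := by
  simpa using Real.lt_tan (Real.arctan_pos.2 hx) (Real.arctan_lt_pi_div_two x)

theorem eventually_gt_of_hasDerivAt_pos {f : ℝ → ℝ} {f' t : ℝ} (hf : HasDerivAt f f' t)
    (h : 0 < f') : ∀ᶠ s in 𝓝[>] t, f t < f s := by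
  have h1 := hasDerivAt_iff_tendsto_slope.1 hf
  have h2 : Tendsto (slope f t) (𝓝[>] t) (𝓝 f') :=
    h1.mono_left (nhdsWithin_mono _ fun y hy => ne_of_gt hy)
  filter_upwards [h2.eventually_const_lt h, self_mem_nhdsWithin] with s hs hst
  rw [slope_def_field] at hs
  have hst' : 0 < s - t := sub_pos.2 hst
  have := (div_pos_iff_of_pos_right hst').1 hs
  linarith

theorem eventually_lt_of_hasDerivAt_neg {f : ℝ → ℝ} {f' t : ℝ} (hf : HasDerivAt f f' t)
    (h : f' < 0) : ∀ᶠ s in 𝓝[>] t, f s < f t := by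
  filter_upwards [eventually_gt_of_hasDerivAt_pos hf.neg (neg_pos.2 h)] with s hs
  simpa using hs

theorem image_sub_le_mul_sub_of_hasDerivAt_le {f f' : ℝ → ℝ} {a b C : ℝ} (hab : a ≤ b)
    (hf : ∀ t ∈ Icc a b, HasDerivAt f (f' t) t) (h : ∀ t ∈ Ioo a b, f' t ≤ C) :
    f b - f a ≤ C * (b - a) := by
  refine (convex_Icc a b).image_sub_le_mul_sub_of_deriv_le
    (fun t ht => (hf t ht).continuousAt.continuousWithinAt) (fun t ht => ?_) (fun t ht => ?_)
    a (left_mem_Icc.2 hab) b (right_mem_Icc.2 hab) hab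
  · exact (hf t (interior_subset ht)).differentiableAt.differentiableWithinAt
  · rw [(hf t (interior_subset ht)).deriv]
    rw [interior_Icc] at ht
    exact h t ht

/-- If `f` converges, `x` does not decrease faster than linearly, and `f` eventually decreases at a
definite rate wherever `x` exceeds some level, then `x` is eventually below any higher level. -/
theorem eventually_lt_of_tendsto_of_decreasing {f f' x x' : ℝ → ℝ} {L K A A' c : ℝ}
    (hf : ∀ t, 0 ≤ t → HasDerivAt f (f' t) t) (hL : Tendsto f atTop (𝓝 L))
    (hx : ∀ t, 0 ≤ t → HasDerivAt x (x' t) t) (hK : 0 < K) (hxK : ∀ t, 0 ≤ t → -K ≤ x' t)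
    (hc : 0 < c) (hA : A' < A) (h : ∀ᶠ t in atTop, A' ≤ x t → f' t ≤ -c) :
    ∀ᶠ t in atTop, x t < A := by
  obtain ⟨T₁, hT₁⟩ := eventually_atTop.1 h
  set w := (A - A') / K with hw
  have hwpos : 0 < w := div_pos (sub_pos.2 hA) hK
  have hKw : K * w = A - A' := by rw [hw]; field_simp
  obtain ⟨T₂, hT₂⟩ := Metric.tendsto_atTop.1 hL (c * w / 4) (by positivity)
  filter_upwards [eventually_ge_atTop (max 0 (max T₁ T₂))] with t ht
  have ht0 : 0 ≤ t := (le_max_left _ _).trans ht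
  have ht1 : T₁ ≤ t := ((le_max_left _ _).trans (le_max_right _ _)).trans ht
  have ht2 : T₂ ≤ t := ((le_max_right _ _).trans (le_max_right _ _)).trans ht
  by_contra! hxA
  have hlow : ∀ s ∈ Ioo t (t + w), A' ≤ x s := by
    intro s hs
    have := image_sub_le_mul_sub_of_hasDerivAt_le (f := fun s => -x s) (f' := fun s => -x' s)
      (C := K) hs.1.le (fun u hu => (hx u (ht0.trans hu.1)).neg)
      (fun u hu => by have := hxK u (ht0.trans hu.1.le); linarith)
    have h2 : K * (s - t) ≤ K * w := mul_le_mul_of_nonneg_left (by linarith [hs.2]) hK.le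
    linarith
  have hdec := image_sub_le_mul_sub_of_hasDerivAt_le (f := f) (f' := f') (C := -c)
    (le_add_of_nonneg_right hwpos.le : t ≤ t + w) (fun u hu => hf u (ht0.trans hu.1))
    (fun u hu => hT₁ u (ht1.trans hu.1.le) (hlow u hu))
  have d1 := abs_lt.1 (hT₂ t ht2)
  have d2 := abs_lt.1 (hT₂ (t + w) (by linarith))
  have : 0 < c * w := mul_pos hc hwpos
  rw [add_sub_cancel_left] at hdec
  linarith [d1.1, d1.2, d2.1, d2.2]

theorem strictMonoOn_phi_integrand {r_a k : ℝ} (ha : 0 < r_a) (hk : 0 < k) :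
    StrictMonoOn (fun x : ℝ => k * √(x ^ 2 - r_a ^ 2) / x - 1 / x) (Ici r_a) := by
  intro x hx y hy hxy
  have hx0 : 0 < x := ha.trans_le hx
  have hy0 : 0 < y := hx0.trans hxy
  have h1 : 1 / y < 1 / x := one_div_lt_one_div_of_lt hx0 hxy
  have hxa : 0 ≤ x ^ 2 - r_a ^ 2 := by nlinarith [mem_Ici.1 hx]
  have hya : 0 ≤ y ^ 2 - r_a ^ 2 := by nlinarith [mem_Ici.1 hy]
  have h2 : √(x ^ 2 - r_a ^ 2) * y ≤ √(y ^ 2 - r_a ^ 2) * x := by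
    rw [← pow_le_pow_iff_left₀ (by positivity) (by positivity) two_ne_zero, mul_pow, mul_pow,
      Real.sq_sqrt hxa, Real.sq_sqrt hya]
    nlinarith [mul_pos ha ha, mul_pos (sub_pos.2 hxy) (add_pos hx0 hy0)]
  have h3 : k * √(x ^ 2 - r_a ^ 2) / x ≤ k * √(y ^ 2 - r_a ^ 2) / y := by
    rw [div_le_div_iff₀ hx0 hy0]
    nlinarith
  simp only
  linarith

theorem continuousOn_phi_integrand {r_a k : ℝ} :
    ContinuousOn (fun x : ℝ => k * √(x ^ 2 - r_a ^ 2) / x - 1 / x) (Ioi 0) := by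
  apply ContinuousOn.sub
  · exact ContinuousOn.div (by fun_prop) continuousOn_id fun x hx => ne_of_gt hx
  · exact ContinuousOn.div (by fun_prop) continuousOn_id fun x hx => ne_of_gt hx

theorem hasDerivAt_phi {r_a r_d k x : ℝ} (hd : 0 < r_d) (hx : 0 < x) :
    HasDerivAt (phi r_a r_d k) (k * √(x ^ 2 - r_a ^ 2) / x - 1 / x) x := by
  have hsub : uIcc r_d x ⊆ Ioi 0 := fun y hy => (lt_min hd hx).trans_le hy.1
  have hcont := continuousOn_phi_integrand (r_a := r_a) (k := k)
  refine integral_hasDerivAt_right (hcont.mono hsub).intervalIntegrable ?_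
    (hcont.continuousAt (Ioi_mem_nhds hx))
  exact hcont.stronglyMeasurableAtFilter isOpen_Ioi x hx

theorem phi_nonneg {r_a r_d k x : ℝ} (ha : 0 < r_a) (had : r_a < r_d) (hk : 0 < k)
    (hkd : k * √(r_d ^ 2 - r_a ^ 2) = 1) (hx : r_a ≤ x) : 0 ≤ phi r_a r_d k x := by
  have hmono := (strictMonoOn_phi_integrand ha hk).monotoneOn
  have hzero : k * √(r_d ^ 2 - r_a ^ 2) / r_d - 1 / r_d = 0 := by rw [hkd]; ring
  unfold phi
  rcases le_total r_d x with h | h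
  · refine integral_nonneg h fun u hu => ?_
    have := hmono (mem_Ici.2 had.le) (mem_Ici.2 (had.le.trans hu.1)) hu.1
    simp only at this
    linarith
  · rw [integral_symm, ← intervalIntegral.integral_neg]
    refine integral_nonneg h fun u hu => ?_
    have := hmono (mem_Ici.2 (hx.trans hu.1)) (mem_Ici.2 had.le) hu.2
    simp only at this
    linarith

theorem ctrl_add {V κ δ r_a r_d k r θ : ℝ} :
    ctrl V κ δ r_a r_d k r θ + V * Real.sin θ / r =
      -V * (k * √(r ^ 2 - r_a ^ 2) / r - 1 / r)
        + κ * Real.cos θ / (δ ^ 2 - (eta r_a r_d k r θ) ^ 2) := by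
  unfold ctrl
  ring

theorem ctrl_self_pos {V κ δ r_a r_d k θ : ℝ} (hV : 0 < V) (hκ : 0 < κ) (ha : 0 < r_a)
    (hη : 0 < δ ^ 2 - (eta r_a r_d k r_a θ) ^ 2) (hθ : 0 < Real.cos θ) :
    0 < ctrl V κ δ r_a r_d k r_a θ := by
  have h1 : 0 ≤ V / r_a * (1 - Real.sin θ) :=
    mul_nonneg (by positivity) (sub_nonneg.2 (Real.sin_le_one θ))
  have h2 : 0 < κ * Real.cos θ / (δ ^ 2 - (eta r_a r_d k r_a θ) ^ 2) := by positivity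
  simp only [ctrl, sub_self, Real.sqrt_zero, mul_zero, zero_div, sub_zero]
  linarith

theorem phi_integrand_abs_le {r_a k x : ℝ} (ha : 0 < r_a) (hk : 0 < k) (hx : r_a ≤ x) :
    |k * √(x ^ 2 - r_a ^ 2) / x - 1 / x| ≤ k + 1 / r_a := by
  have hx0 := ha.trans_le hx
  have h1 : k * √(x ^ 2 - r_a ^ 2) / x ≤ k := by
    rw [div_le_iff₀ hx0]
    exact mul_le_mul_of_nonneg_left (Real.sqrt_le_iff.2 ⟨hx0.le, by nlinarith⟩) hk.le
  have h2 : 0 ≤ k * √(x ^ 2 - r_a ^ 2) / x := by positivity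
  have h3 : 1 / x ≤ 1 / r_a := one_div_le_one_div_of_le ha hx
  have h4 : 0 < 1 / x := by positivity
  rw [abs_le]
  constructor <;> linarith

theorem sq_sub_eta_sq_pos {δ r_a r_d k : ℝ} (ha : 0 < r_a) (had : r_a < r_d) (hk : 0 < k)
    (hkd : k * √(r_d ^ 2 - r_a ^ 2) = 1) {x y : ℝ} (hx : r_a ≤ x)
    (hη : eta r_a r_d k x y < δ) : 0 < δ ^ 2 - (eta r_a r_d k x y) ^ 2 := by
  have h0 : 0 ≤ eta r_a r_d k x y :=
    add_nonneg (sub_nonneg.2 (Real.sin_le_one _)) (phi_nonneg ha had hk hkd hx)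
  nlinarith

theorem mem_Ioo_of_sin_pos {θ : ℝ → ℝ} (hθ : ∀ t, 0 ≤ t → ContinuousAt θ t)
    (h0 : θ 0 ∈ Ioo 0 π) (hsin : ∀ t, 0 ≤ t → 0 < Real.sin (θ t)) {t : ℝ} (ht : 0 ≤ t) :
    θ t ∈ Ioo 0 π := by
  have hc : ContinuousOn θ (Icc 0 t) := fun s hs => (hθ s hs.1).continuousWithinAt
  constructor
  · by_contra! hle
    obtain ⟨s, hs, hs0⟩ := intermediate_value_Icc' ht hc ⟨hle, h0.1.le⟩
    simpa [hs0] using hsin s hs.1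
  · by_contra! hle
    obtain ⟨s, hs, hs0⟩ := intermediate_value_Icc ht hc ⟨h0.2.le, hle⟩
    simpa [hs0] using hsin s hs.1

/-- Trajectories of the hybrid closed loop. -/
structure ClosedLoop (V κ δ r_a r_d k : ℝ) (r θ : ℝ → ℝ) : Prop where
  hasDerivAt_r : ∀ t, 0 ≤ t → HasDerivAt r (-V * Real.cos (θ t)) t
  hasDerivAt_θ : ∀ t, 0 ≤ t →
    HasDerivAt θ (Omega V κ δ r_a r_d k (r t) (θ t) + V * Real.sin (θ t) / r t) t

namespace ClosedLoop

variable {V κ δ r_a r_d k : ℝ} {r θ : ℝ → ℝ}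

theorem hasDerivAt_θ_of_le (h : ClosedLoop V κ δ r_a r_d k r θ) {t : ℝ} (ht : 0 ≤ t)
    (hrt : r_a ≤ r t) :
    HasDerivAt θ (-V * (k * √(r t ^ 2 - r_a ^ 2) / r t - 1 / r t)
        + κ * Real.cos (θ t) / (δ ^ 2 - (eta r_a r_d k (r t) (θ t)) ^ 2)) t := by
  have := h.hasDerivAt_θ t ht
  rwa [Omega, if_pos hrt, ctrl_add] at this

theorem hasDerivAt_eta (h : ClosedLoop V κ δ r_a r_d k r θ) (ha : 0 < r_a) (hd : 0 < r_d) {t : ℝ}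
    (ht : 0 ≤ t) (hrt : r_a ≤ r t) :
    HasDerivAt (fun s => eta r_a r_d k (r s) (θ s))
      (-(κ * Real.cos (θ t) ^ 2 / (δ ^ 2 - (eta r_a r_d k (r t) (θ t)) ^ 2))) t := by
  have h1 := (h.hasDerivAt_θ_of_le ht hrt).sin
  have h2 := (hasDerivAt_phi (r_a := r_a) (k := k) hd (ha.trans_le hrt)).comp t
    (h.hasDerivAt_r t ht)
  refine ((h1.const_sub 1).add h2).congr_deriv ?_
  ring

theorem eta_le_of_le (h : ClosedLoop V κ δ r_a r_d k r θ) (hκ : 0 < κ) (ha : 0 < r_a)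
    (had : r_a < r_d) (hk : 0 < k) (hkd : k * √(r_d ^ 2 - r_a ^ 2) = 1) {a b : ℝ} (ha0 : 0 ≤ a)
    (hab : a ≤ b) (hr : ∀ t ∈ Icc a b, r_a ≤ r t) (hη : eta r_a r_d k (r a) (θ a) < δ) :
    eta r_a r_d k (r b) (θ b) ≤ eta r_a r_d k (r a) (θ a) := by
  set E := fun s => eta r_a r_d k (r s) (θ s) with hE
  have hder : ∀ t ∈ Icc a b, HasDerivAt E
      (-(κ * Real.cos (θ t) ^ 2 / (δ ^ 2 - (E t) ^ 2))) t := fun t ht =>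
    h.hasDerivAt_eta ha (ha.trans had) (ha0.trans ht.1) (hr t ht)
  change E b ≤ E a
  change E a < δ at hη
  refine le_of_forall_pos_lt_add fun ε hε => ?_
  have hba : 0 < b - a + 1 := by linarith
  set c := min ε (δ - E a) / (b - a + 1) with hc
  have hm : 0 < min ε (δ - E a) := lt_min hε (sub_pos.2 hη)
  have hcpos : 0 < c := div_pos hm hba
  have hcb : c * (b - a + 1) = min ε (δ - E a) := by rw [hc]; field_simp
  have hfence := image_le_of_deriv_right_lt_deriv_boundary (f := E)
    (f' := fun t => -(κ * Real.cos (θ t) ^ 2 / (δ ^ 2 - (E t) ^ 2))) (a := a) (b := b)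
    (fun t ht => (hder t ht).continuousAt.continuousWithinAt)
    (fun t ht => (hder t (Ico_subset_Icc_self ht)).hasDerivWithinAt)
    (B := fun t => E a + c * (t - a)) (B' := fun _ => c) (by simp)
    (fun t => by simpa using (((hasDerivAt_id t).sub_const a).const_mul c).const_add (E a))
    (fun t ht heq => by
      have hlt : E t < δ := by
        rw [heq]
        nlinarith [min_le_right ε (δ - E a), ht.2]
      have := sq_sub_eta_sq_pos (δ := δ) ha had hk hkd (hr t (Ico_subset_Icc_self ht)) hlt
      have : 0 ≤ κ * Real.cos (θ t) ^ 2 / (δ ^ 2 - (E t) ^ 2) := by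
        apply div_nonneg (by positivity) this.le
      linarith) (right_mem_Icc.2 hab)
  nlinarith [min_le_left ε (δ - E a)]

/-- A trajectory on or outside the auxiliary circle does not cross it inwards: where it would, the
derivative of `θ` would have a jump, which is impossible for a derivative. -/
theorem eventually_le (h : ClosedLoop V κ δ r_a r_d k r θ) (hV : 0 < V) (hκ : 0 < κ) (ha : 0 < r_a)
    (had : r_a < r_d) (hk : 0 < k) (hkd : k * √(r_d ^ 2 - r_a ^ 2) = 1) (hδ : δ < 1) {t : ℝ}
    (ht : 0 ≤ t) (hrt : r_a ≤ r t) (hη : eta r_a r_d k (r t) (θ t) < δ) :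
    ∀ᶠ s in 𝓝[>] t, r_a ≤ r s := by
  have hrd := h.hasDerivAt_r t ht
  rcases hrt.lt_or_eq with hlt | heq
  · exact (hrd.continuousAt.eventually_const_lt hlt).filter_mono nhdsWithin_le_nhds
      |>.mono fun s hs => hs.le
  rcases lt_trichotomy (Real.cos (θ t)) 0 with hc | hc | hc
  · filter_upwards [eventually_gt_of_hasDerivAt_pos hrd (by nlinarith)] with s hs
    linarith
  · have hsin : Real.sin (θ t) = 1 := by
      have h1 : 0 < Real.sin (θ t) := by
        have := phi_nonneg ha had hk hkd hrt
        unfold eta at hη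
        linarith
      nlinarith [Real.sin_sq_add_cos_sq (θ t)]
    have hcosd := (h.hasDerivAt_θ_of_le ht hrt).cos
    rw [hsin, hc, ← heq, sub_self, Real.sqrt_zero] at hcosd
    have hneg := eventually_lt_of_hasDerivAt_neg hcosd (by
      have : 0 < V * (1 / r_a) := by positivity
      simp only [mul_zero, zero_div]
      linarith)
    obtain ⟨b, hb, hbt⟩ := mem_nhdsGT_iff_exists_Ioo_subset.1 hneg
    filter_upwards [Ioo_mem_nhdsGT hb] with s hs
    have := image_sub_le_mul_sub_of_hasDerivAt_le (f := fun s => -r s) (C := 0) hs.1.le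
      (fun u hu => (h.hasDerivAt_r u (ht.trans hu.1)).neg) (fun u hu => by
        have := hbt ⟨hu.1, hu.2.trans hs.2⟩
        rw [mem_ofPred_eq, hc] at this
        nlinarith)
    linarith
  · exfalso
    have hlt : ∀ᶠ s in 𝓝[>] t, r s < r_a := by
      rw [heq]
      exact eventually_lt_of_hasDerivAt_neg hrd (by nlinarith)
    have hθt := h.hasDerivAt_θ t ht
    have hlim : Tendsto (deriv θ) (𝓝[>] t) (𝓝 (V * Real.sin (θ t) / r t)) := by
      have hcont : ContinuousAt (fun s => V * Real.sin (θ s) / r s) t :=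
        (continuousAt_const.mul hθt.sin.continuousAt).div hrd.continuousAt
          (ha.trans_le hrt).ne'
      refine (hcont.tendsto.mono_left nhdsWithin_le_nhds).congr' ?_
      filter_upwards [hlt, self_mem_nhdsWithin] with s hs hst
      rw [(h.hasDerivAt_θ s (ht.trans (le_of_lt hst))).deriv, Omega, if_neg (not_le.2 hs),
        zero_add]
    have hright : HasDerivWithinAt θ (V * Real.sin (θ t) / r t) (Ici t) t :=
      hasDerivWithinAt_Ici_of_tendsto_deriv (s := Ioi t)
        (fun s hs => (h.hasDerivAt_θ s
          (ht.trans (le_of_lt hs))).differentiableAt.differentiableWithinAt)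
        hθt.continuousAt.continuousWithinAt self_mem_nhdsWithin hlim
    have huniq := (uniqueDiffWithinAt_Ici t).eq_deriv _ hθt.hasDerivWithinAt hright
    rw [Omega, if_pos hrt] at huniq
    have hpos := sq_sub_eta_sq_pos ha had hk hkd hrt hη
    rw [← heq] at hpos huniq
    linarith [ctrl_self_pos hV hκ ha hpos hc]

theorem le_and_eta_le (h : ClosedLoop V κ δ r_a r_d k r θ) (hV : 0 < V) (hκ : 0 < κ) (ha : 0 < r_a)
    (had : r_a < r_d) (hk : 0 < k) (hkd : k * √(r_d ^ 2 - r_a ^ 2) = 1) (hδ : δ < 1)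
    (hr0 : r_a ≤ r 0) (hη0 : eta r_a r_d k (r 0) (θ 0) < δ) {t : ℝ} (ht : 0 ≤ t) :
    r_a ≤ r t ∧ eta r_a r_d k (r t) (θ t) ≤ eta r_a r_d k (r 0) (θ 0) := by
  set S := {s | r_a ≤ r s ∧ eta r_a r_d k (r s) (θ s) ≤ eta r_a r_d k (r 0) (θ 0)} with hS
  have hrc : ContinuousOn r (Icc 0 t) := fun s hs =>
    (h.hasDerivAt_r s hs.1).continuousAt.continuousWithinAt
  have hclosed : IsClosed (S ∩ Icc 0 t) := by
    have h1 : IsClosed (Icc 0 t ∩ r ⁻¹' Ici r_a) :=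
      hrc.preimage_isClosed_of_isClosed isClosed_Icc isClosed_Ici
    have hηc : ContinuousOn (fun s => eta r_a r_d k (r s) (θ s)) (Icc 0 t ∩ r ⁻¹' Ici r_a) :=
      fun s hs => (h.hasDerivAt_eta ha (ha.trans had) hs.1.1
        hs.2).continuousAt.continuousWithinAt
    have h2 := hηc.preimage_isClosed_of_isClosed h1
      (isClosed_Iic (a := eta r_a r_d k (r 0) (θ 0)))
    convert h2 using 1
    ext s
    simp only [hS, mem_inter_iff, mem_ofPred_eq, mem_preimage, mem_Ici, mem_Iic]
    tauto
  have hsub := hclosed.Icc_subset_of_forall_mem_nhdsWithin ⟨hr0, le_rfl⟩ (fun s hs => by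
    obtain ⟨⟨hrs, hηs⟩, hs0, hst⟩ := hs
    have hηδ := hηs.trans_lt hη0
    have hev := h.eventually_le hV hκ ha had hk hkd hδ hs0 hrs hηδ
    obtain ⟨b, hb, hbs⟩ := mem_nhdsGT_iff_exists_Ioo_subset.1 hev
    filter_upwards [Ioo_mem_nhdsGT hb] with u hu
    refine ⟨hbs hu, (h.eta_le_of_le hκ ha had hk hkd hs0 hu.1.le (fun v hv => ?_) hηδ).trans hηs⟩
    rcases hv.1.eq_or_lt with rfl | hlt
    · exact hrs
    · exact hbs ⟨hlt, hv.2.trans_lt hu.2⟩)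
  exact hsub ⟨ht, le_rfl⟩

theorem tendsto_cos (h : ClosedLoop V κ δ r_a r_d k r θ) (hV : 0 < V) (hκ : 0 < κ) (ha : 0 < r_a)
    (had : r_a < r_d) (hk : 0 < k) (hkd : k * √(r_d ^ 2 - r_a ^ 2) = 1) {e : ℝ}
    (heδ : e < δ) (hr : ∀ t, 0 ≤ t → r_a ≤ r t)
    (hη : ∀ t, 0 ≤ t → eta r_a r_d k (r t) (θ t) ≤ e) :
    Tendsto (fun t => Real.cos (θ t)) atTop (𝓝 0) ∧
      Tendsto (fun t => κ * Real.cos (θ t) / (δ ^ 2 - (eta r_a r_d k (r t) (θ t)) ^ 2))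
        atTop (𝓝 0) := by
  set E := fun s => eta r_a r_d k (r s) (θ s) with hE
  have hE0 : ∀ t, 0 ≤ t → 0 ≤ E t := fun t ht =>
    add_nonneg (sub_nonneg.2 (Real.sin_le_one _)) (phi_nonneg ha had hk hkd (hr t ht))
  have he : 0 ≤ e := (hE0 0 le_rfl).trans (hη 0 le_rfl)
  have hδ : 0 < δ := he.trans_lt heδ
  have hD : 0 < δ ^ 2 - e ^ 2 := by nlinarith
  have hDE : ∀ t, 0 ≤ t → δ ^ 2 - e ^ 2 ≤ δ ^ 2 - E t ^ 2 := fun t ht => by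
    nlinarith [hE0 t ht, hη t ht]
  have hfeed : ∀ t, 0 ≤ t → |κ * Real.cos (θ t) / (δ ^ 2 - E t ^ 2)| ≤
      κ / (δ ^ 2 - e ^ 2) * |Real.cos (θ t)| := fun t ht => by
    rw [abs_div, abs_mul, abs_of_pos hκ, abs_of_pos (hD.trans_le (hDE t ht)), div_mul_eq_mul_div]
    exact div_le_div_of_nonneg_left (by positivity) hD (hDE t ht)
  have hanti : ∀ a b, 0 ≤ a → a ≤ b → E b ≤ E a := fun a b ha0 hab =>
    h.eta_le_of_le hκ ha had hk hkd ha0 hab (fun t ht => hr t (ha0.trans ht.1))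
      ((hη a ha0).trans_lt heδ)
  obtain ⟨L, hL⟩ : ∃ L, Tendsto E atTop (𝓝 L) := by
    have hA : Antitone fun t => E (max t 0) := fun a b hab =>
      hanti _ _ (le_max_right _ _) (max_le_max_right 0 hab)
    refine ⟨_, (tendsto_atTop_ciInf hA ⟨0, ?_⟩).congr' ?_⟩
    · rintro _ ⟨t, rfl⟩
      exact hE0 _ (le_max_right _ _)
    · filter_upwards [eventually_ge_atTop 0] with t ht
      rw [max_eq_left ht]
  set M := V * (k + 1 / r_a) + κ / (δ ^ 2 - e ^ 2) with hM
  have hMpos : 0 < M := by positivity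
  set θ' := fun t => -V * (k * √(r t ^ 2 - r_a ^ 2) / r t - 1 / r t)
        + κ * Real.cos (θ t) / (δ ^ 2 - E t ^ 2) with hθ'
  have hθ'M : ∀ t, 0 ≤ t → |Real.sin (θ t) * θ' t| ≤ M := fun t ht => by
    have h1 : |θ' t| ≤ M := by
      refine (abs_add_le _ _).trans (add_le_add ?_ ?_)
      · rw [abs_mul, abs_neg, abs_of_pos hV]
        exact mul_le_mul_of_nonneg_left (phi_integrand_abs_le ha hk (hr t ht)) hV.le
      · exact (hfeed t ht).trans (mul_le_of_le_one_right (by positivity)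
          (Real.abs_cos_le_one _))
    rw [abs_mul]
    exact (mul_le_of_le_one_left (abs_nonneg _) (Real.abs_sin_le_one _)).trans h1
  have hcosd : ∀ t, 0 ≤ t → HasDerivAt (fun s => Real.cos (θ s)) (-Real.sin (θ t) * θ' t) t :=
    fun t ht => (h.hasDerivAt_θ_of_le ht (hr t ht)).cos
  have hdec : ∀ ε, 0 < ε → ∀ t, 0 ≤ t → ε ≤ |Real.cos (θ t)| →
      -(κ * Real.cos (θ t) ^ 2 / (δ ^ 2 - E t ^ 2)) ≤ -(κ * ε ^ 2 / δ ^ 2) :=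
    fun ε hε t ht hc => by
      have hsq : ε ^ 2 ≤ Real.cos (θ t) ^ 2 := by
        rw [← sq_abs (Real.cos (θ t))]
        exact pow_le_pow_left₀ hε.le hc 2
      exact neg_le_neg (div_le_div₀ (by positivity) (mul_le_mul_of_nonneg_left hsq hκ.le)
        (hD.trans_le (hDE t ht)) (by nlinarith [sq_nonneg (E t)]))
  have hEd := fun t (ht : 0 ≤ t) => h.hasDerivAt_eta ha (ha.trans had) ht (hr t ht)
  have hcos : Tendsto (fun t => Real.cos (θ t)) atTop (𝓝 0) := by
    refine tendsto_order.2 ⟨fun ε hε => ?_, fun ε hε => ?_⟩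
    · have := eventually_lt_of_tendsto_of_decreasing (x := fun s => -Real.cos (θ s))
        (A := -ε) (A' := -ε / 2) hEd hL (fun t ht => (hcosd t ht).neg) hMpos
        (fun t ht => by linarith [(abs_le.1 (hθ'M t ht)).1])
        (c := κ * (-ε / 2) ^ 2 / δ ^ 2)
        (by have : -ε / 2 ≠ 0 := by linarith
            positivity) (by linarith)
        (by
          filter_upwards [eventually_ge_atTop 0] with t ht hc
          exact hdec _ (by linarith) t ht (hc.trans (neg_le_abs _)))
      filter_upwards [this] with t ht
      linarith
    · exact eventually_lt_of_tendsto_of_decreasing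
        (A := ε) (A' := ε / 2) hEd hL hcosd hMpos
        (fun t ht => by linarith [(abs_le.1 (hθ'M t ht)).2])
        (c := κ * (ε / 2) ^ 2 / δ ^ 2) (by positivity) (by linarith)
        (by
          filter_upwards [eventually_ge_atTop 0] with t ht hc
          exact hdec _ (by linarith) t ht (hc.trans (le_abs_self _)))
  refine ⟨hcos, squeeze_zero_norm' ?_ (by simpa using hcos.abs.const_mul (κ / (δ ^ 2 - e ^ 2)))⟩
  filter_upwards [eventually_ge_atTop 0] with t ht
  exact hfeed t ht

theorem tendsto_r (h : ClosedLoop V κ δ r_a r_d k r θ) (hV : 0 < V) (ha : 0 < r_a)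
    (had : r_a < r_d) (hk : 0 < k) (hkd : k * √(r_d ^ 2 - r_a ^ 2) = 1)
    (hr : ∀ t, 0 ≤ t → r_a ≤ r t) {L : ℝ} (hθ : Tendsto θ atTop (𝓝 L))
    (hfeed : Tendsto (fun t => κ * Real.cos (θ t) / (δ ^ 2 - (eta r_a r_d k (r t) (θ t)) ^ 2))
        atTop (𝓝 0)) :
    Tendsto r atTop (𝓝 r_d) := by
  set g := fun x : ℝ => k * √(x ^ 2 - r_a ^ 2) / x - 1 / x with hg
  have hmono : StrictMonoOn g (Ici r_a) := strictMonoOn_phi_integrand ha hk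
  have hzero : g r_d = 0 := by
    simp only [hg]
    rw [hkd]
    ring
  have hθd := fun t (ht : 0 ≤ t) => h.hasDerivAt_θ_of_le ht (hr t ht)
  refine tendsto_order.2 ⟨fun A hA => ?_, fun A hA => ?_⟩
  · set A' := max ((A + r_d) / 2) r_a with hA'
    have hA'd : A' < r_d := max_lt (by linarith) had
    have hAA' : A < A' := lt_max_of_lt_left (by linarith)
    have hgA' : g A' < 0 := hzero ▸ hmono (mem_Ici.2 (le_max_right _ _)) (mem_Ici.2 had.le) hA'd
    have hc : 0 < V * -g A' / 2 := by
      have := neg_pos.2 hgA'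
      positivity
    have := eventually_lt_of_tendsto_of_decreasing (x := fun s => -r s) (A := -A) (A' := -A')
      (c := V * -g A' / 2) (fun t ht => (hθd t ht).neg) hθ.neg
      (fun t ht => (h.hasDerivAt_r t ht).neg) hV
      (fun t _ => by nlinarith [Real.neg_one_le_cos (θ t)]) hc (by linarith)
      (by
        filter_upwards [eventually_ge_atTop 0, hfeed.eventually_const_lt (neg_lt_zero.2 hc)]
          with t ht hft hle
        have h1 : g (r t) ≤ g A' :=
          hmono.monotoneOn (hr t ht) (mem_Ici.2 (le_max_right _ _)) (by linarith)
        have := mul_le_mul_of_nonneg_left h1 hV.le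
        simp only [hg] at this hft ⊢
        linarith)
    filter_upwards [this] with t ht
    linarith
  · set A' := (A + r_d) / 2 with hA'
    have hA'd : r_d < A' := by rw [hA']; linarith
    have haA' : r_a ≤ A' := by linarith
    have hgA' : 0 < g A' := hzero ▸ hmono (mem_Ici.2 had.le) (mem_Ici.2 haA') hA'd
    have hc : 0 < V * g A' / 2 := by positivity
    exact eventually_lt_of_tendsto_of_decreasing (A := A) (A' := A')
      (c := V * g A' / 2) hθd hθ h.hasDerivAt_r hV
      (fun t _ => by nlinarith [Real.cos_le_one (θ t)]) hc (by rw [hA']; linarith)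
      (by
        filter_upwards [eventually_ge_atTop 0, hfeed.eventually_lt_const hc] with t ht hft hle
        have h1 : g A' ≤ g (r t) := hmono.monotoneOn (mem_Ici.2 haA') (hr t ht) hle
        have := mul_le_mul_of_nonneg_left h1 hV.le
        simp only [hg] at this hft ⊢
        linarith)

end ClosedLoop

theorem stmt_11 (V κ δ r_s r_a r_d k : ℝ) (hV : 0 < V) (hκ : 0 < κ)
    (h0 : 0 < r_s) (h1 : r_s < r_a) (h2 : r_a < r_d)
    (h3 : r_d < r_s + r_a) (h4 : r_d * r_s < r_a ^ 2)
    (hk : k = 1 / Real.sqrt (r_d ^ 2 - r_a ^ 2))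
    (hδ0 : 0 < δ)
    (hδ : δ ≤ Real.arctan (Real.sqrt (r_d ^ 2 - r_a ^ 2) / r_a)
            / (Real.sqrt (r_d ^ 2 - r_a ^ 2) / r_a)
          + Real.log (r_d / r_a) - r_s / r_a)
    (r θ : ℝ → ℝ)
    (hr : ∀ t, 0 ≤ t → HasDerivAt r (-V * Real.cos (θ t)) t)
    (hθ : ∀ t, 0 ≤ t →
      HasDerivAt θ (Omega V κ δ r_a r_d k (r t) (θ t) + V * Real.sin (θ t) / r t) t)
    (hr0 : r_a ≤ r 0) (hθ0 : θ 0 ∈ Set.Ioo 0 Real.pi)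
    (hη0 : eta r_a r_d k (r 0) (θ 0) < δ) :
    Tendsto r atTop (nhds r_d) ∧ Tendsto θ atTop (nhds (Real.pi / 2)) ∧
    ∀ t, 0 ≤ t → r_s ≤ r t := by

  have ha : 0 < r_a := h0.trans h1
  have hS : 0 < √(r_d ^ 2 - r_a ^ 2) := Real.sqrt_pos.2 (by nlinarith)
  have hkpos : 0 < k := by rw [hk]; positivity
  have hkd : k * √(r_d ^ 2 - r_a ^ 2) = 1 := by rw [hk]; field_simp
  have hδ1 : δ < 1 := by
    have hβ : 0 < √(r_d ^ 2 - r_a ^ 2) / r_a := by positivity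
    have harctan := (div_lt_one hβ).2 (arctan_lt_self_of_pos hβ)
    have hlog := Real.log_le_sub_one_of_pos (div_pos (ha.trans h2) ha)
    have hlt : r_d / r_a < r_s / r_a + 1 := by
      rw [div_add_one ha.ne']
      exact div_lt_div_of_pos_right h3 ha
    linarith
  have h : ClosedLoop V κ δ r_a r_d k r θ := ⟨hr, hθ⟩
  have hinv := fun t (ht : 0 ≤ t) => h.le_and_eta_le hV hκ ha h2 hkpos hkd hδ1 hr0 hη0 ht
  obtain ⟨hcos, hfeed⟩ := h.tendsto_cos hV hκ ha h2 hkpos hkd hη0 (fun t ht => (hinv t ht).1)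
    (fun t ht => (hinv t ht).2)
  have hsin : ∀ t, 0 ≤ t → 0 < Real.sin (θ t) := fun t ht => by
    have h4 := phi_nonneg ha h2 hkpos hkd (hinv t ht).1
    have h5 := (hinv t ht).2.trans_lt hη0
    unfold eta at h5
    linarith
  have hθlim : Tendsto θ atTop (𝓝 (π / 2)) := by
    rw [← Real.arccos_zero]
    refine ((Real.continuous_arccos.tendsto 0).comp hcos).congr' ?_
    filter_upwards [eventually_ge_atTop 0] with t ht
    have hmem := mem_Ioo_of_sin_pos (fun s hs => (hθ s hs).continuousAt) hθ0 hsin ht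
    exact Real.arccos_cos hmem.1.le hmem.2.le
  exact ⟨h.tendsto_r hV ha h2 hkpos hkd (fun t ht => (hinv t ht).1) hθlim hfeed, hθlim,
    fun t ht => h1.le.trans (hinv t ht).1⟩
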